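/- Let A be a torsion abelian group and φ an endomorphism of A. Then the following are equivalent: (MF) there exists a subgroup A₀ of finite index in A such that φ(X) ⊆ X for every subgroup X of A₀; (FM) there exists a finite subgroup A₁ of A such that φ(X) ⊆ X + A₁ for every subgroup X of A (i.e. φ induces a power endomorphism on A/A₁). -/

import Mathlib

/-- In an abelian group, if `φ` maps every element into the cyclic subgroup it generates and acts
on `g` as multiplication by `m`, then it does so on every element killed by the order of `g`. -/
theorem eq_zsmul_of_addOrderOf_nsmul_eq_zero {B : Type*} [AddCommGroup B] (φ : B →+ B)
    (hφ : ∀ x, ∃ k : ℤ, φ x = k • x) {g y : B} (hg : 0 < addOrderOf g)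
    (hy : addOrderOf g • y = 0) {m : ℤ} (hm : φ g = m • g) : φ y = m • y := by
  let π := QuotientAddGroup.mk' (AddSubgroup.zmultiples g)
  have hπ (x : B) : π x = 0 ↔ ∃ k : ℤ, k • g = x := by
    rw [QuotientAddGroup.mk'_apply, QuotientAddGroup.eq_zero_iff, AddSubgroup.mem_zmultiples_iff]
  set d := addOrderOf (π y) with hd
  obtain ⟨c, hc⟩ : d ∣ addOrderOf g := by
    rw [hd, addOrderOf_dvd_iff_nsmul_eq_zero, ← map_nsmul, hy, map_zero]
  have hc0 : (c : ℤ) ≠ 0 := by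
    rintro h
    have : c = 0 := by exact_mod_cast h
    rw [this, mul_zero] at hc
    exact hg.ne' hc
  obtain ⟨u, hu⟩ := (hπ (d • y)).1 (by rw [map_nsmul, hd, addOrderOf_nsmul_eq_zero])
  obtain ⟨v, rfl⟩ : (d : ℤ) ∣ u := by
    have h : (addOrderOf g : ℤ) ∣ c * u := by
      rw [addOrderOf_dvd_iff_zsmul_eq_zero, mul_smul, hu, natCast_zsmul, ← mul_nsmul, ← hc, hy]
    rw [hc, Nat.cast_mul, mul_comm] at h
    exact (mul_dvd_mul_iff_left hc0).1 h
  obtain ⟨z, rfl⟩ : ∃ z, y = z + v • g := ⟨y - v • g, by abel⟩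
  have hdz : d • z = 0 := by
    rw [nsmul_add, mul_smul, natCast_zsmul] at hu
    exact right_eq_add.1 hu
  have hzg : addOrderOf g • z = 0 := by rw [hc, mul_nsmul, hdz, nsmul_zero]
  have hgπ : π g = 0 := (hπ g).2 ⟨1, one_zsmul g⟩
  have hz (k l : ℤ) (h : k • z = l • g) : k • z = 0 := by
    have h1 : (d : ℤ) ∣ k := by
      rw [hd, addOrderOf_dvd_iff_zsmul_eq_zero, map_add, map_zsmul, hgπ, smul_zero, add_zero,
        ← map_zsmul, h, map_zsmul, hgπ, smul_zero]
    obtain ⟨j, rfl⟩ := h1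
    rw [mul_comm, mul_smul, natCast_zsmul, hdz, smul_zero]
  obtain ⟨k, hk⟩ := hφ z
  obtain ⟨l, hl⟩ := hφ (z + g)
  rw [map_add, hk, hm, smul_add] at hl
  have h1 : (k - l) • z = (l - m) • g := by
    rw [sub_smul, sub_smul, sub_eq_sub_iff_add_eq_add, hl, add_comm]
  have h2 := hz _ _ h1
  rw [h2, eq_comm, ← addOrderOf_dvd_iff_zsmul_eq_zero] at h1
  obtain ⟨j, hj⟩ := h1
  have h3 : (l - m) • z = 0 := by
    rw [hj, mul_comm, mul_smul, natCast_zsmul, hzg, smul_zero]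
  rw [sub_smul, sub_eq_zero] at h2 h3
  rw [map_add, map_zsmul, hk, hm, h2, h3, smul_add, smul_comm]

/-- Finitely many torsion elements have orders all dividing the order of a single element. -/
theorem exists_forall_addOrderOf_dvd {B : Type*} [AddCommGroup B] (htor : IsAddTorsion B)
    (S : Finset B) : ∃ g : B, ∀ x ∈ S, addOrderOf x ∣ addOrderOf g := by
  classical
  induction S using Finset.induction_on with
  | empty => exact ⟨0, by simp⟩
  | insert a S _ ih =>
    obtain ⟨g, hg⟩ := ih
    obtain ⟨c, hc⟩ : ∃ c : B, addOrderOf c = (addOrderOf a).lcm (addOrderOf g) :=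
      ⟨_, (AddCommute.all a g).addOrderOf_add_nsmul_eq_lcm
        (htor a).addOrderOf_pos.ne' (htor g).addOrderOf_pos.ne'⟩
    refine ⟨c, fun x hx => hc ▸ ?_⟩
    rcases Finset.mem_insert.1 hx with rfl | hx
    · exact Nat.dvd_lcm_left _ _
    · exact (hg x hx).trans (Nat.dvd_lcm_right _ _)

/-- A power endomorphism of a torsion abelian group acts on each finite set as multiplication by
an integer. -/
theorem exists_zsmul_eq_on_finset {B : Type*} [AddCommGroup B] (htor : IsAddTorsion B)
    (φ : B →+ B) (hφ : ∀ x, ∃ k : ℤ, φ x = k • x) (S : Finset B) :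
    ∃ m : ℤ, ∀ x ∈ S, φ x = m • x := by
  obtain ⟨g, hg⟩ := exists_forall_addOrderOf_dvd htor S
  obtain ⟨m, hm⟩ := hφ g
  exact ⟨m, fun x hx => eq_zsmul_of_addOrderOf_nsmul_eq_zero φ hφ (htor g).addOrderOf_pos
    (addOrderOf_dvd_iff_nsmul_eq_zero.1 (hg x hx)) hm⟩

/-- If on each finite set `φ` is congruent to an integer multiplication modulo a finite subgroup,
then it is a power endomorphism on a subgroup of finite index. -/
theorem exists_finite_index_of_forall_finset {A : Type*} [AddCommGroup A] (φ : A →+ A)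
    (A₁ : AddSubgroup A) (hfin : (A₁ : Set A).Finite)
    (h : ∀ S : Finset A, ∃ m : ℤ, ∀ x ∈ S, φ x - m • x ∈ A₁) :
    ∃ A₀ : AddSubgroup A, A₀.index ≠ 0 ∧ ∀ x ∈ A₀, ∃ k : ℤ, φ x = k • x := by
  classical
  choose m hm using h
  let U : Ultrafilter (Finset A) := Ultrafilter.of Filter.atTop
  have hlim (x : A) : ∃ a ∈ (A₁ : Set A), ∀ᶠ S in (U : Filter (Finset A)), φ x - m S • x = a := by
    have h : ∀ᶠ S in (U : Filter (Finset A)), ∃ a ∈ (A₁ : Set A), φ x - m S • x = a := by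
      refine Ultrafilter.of_le Filter.atTop ?_
      filter_upwards [Filter.eventually_ge_atTop {x}] with S hS
      exact ⟨_, hm S x (Finset.singleton_subset_iff.1 hS), rfl⟩
    exact (Ultrafilter.eventually_exists_mem_iff hfin).1 h
  choose ψ hψ hψU using hlim
  let Ψ : A →+ A := AddMonoidHom.mk' ψ fun x y => by
    obtain ⟨S, hx, hy, hxy⟩ := ((hψU x).and ((hψU y).and (hψU (x + y)))).exists
    rw [← hx, ← hy, ← hxy, map_add, smul_add]
    abel
  refine ⟨Ψ.ker, ?_, fun x hx => ?_⟩
  · have : Finite Ψ.range := hfin.subset (by rintro _ ⟨x, rfl⟩; exact hψ x)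
    rw [AddSubgroup.index_ker]
    exact Nat.card_pos.ne'
  · obtain ⟨S, hS⟩ := (hψU x).exists
    have h0 : ψ x = 0 := hx
    exact ⟨m S, by rwa [h0, sub_eq_zero] at hS⟩

/-- In a torsion abelian group, the subgroup generated by a finite set is finite. -/
theorem finite_closure_of_isTorsion {A : Type*} [AddCommGroup A] (htor : IsAddTorsion A)
    {T : Set A} (hT : T.Finite) : (AddSubgroup.closure T : Set A).Finite := by
  have : AddGroup.FG (AddSubgroup.closure T) :=
    (AddGroup.fg_iff_addSubgroup_fg _).2 ⟨hT.toFinset, by simp⟩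
  exact AddCommGroup.finite_of_fg_isAddTorsion _ (htor.addSubgroup _)

/-- For an endomorphism `φ` of a torsion abelian group `A`, acting as a multiplication
(power endomorphism) on a subgroup of finite index (MF) is equivalent to acting as a
multiplication modulo a finite subgroup (FM). -/
theorem stmt_12 {A : Type*} [AddCommGroup A] (htor : AddMonoid.IsTorsion A)
    (φ : A →+ A) :
    (∃ A₀ : AddSubgroup A, A₀.index ≠ 0 ∧
        ∀ X : AddSubgroup A, X ≤ A₀ → X.map φ ≤ X) ↔
    (∃ A₁ : AddSubgroup A, (A₁ : Set A).Finite ∧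
        ∀ X : AddSubgroup A, X.map φ ≤ X ⊔ A₁) := by
  constructor
  · rintro ⟨A₀, hindex, h⟩
    have : A₀.FiniteIndex := ⟨hindex⟩
    have : Finite (A ⧸ A₀) := AddSubgroup.finite_quotient_of_finiteIndex
    let T : Set A := Set.range (Quotient.out : A ⧸ A₀ → A)
    have hT : T.Finite := Set.finite_range (ι := A ⧸ A₀) _
    refine ⟨AddSubgroup.closure (T ∪ φ '' T),
      finite_closure_of_isTorsion htor (hT.union (hT.image φ)), ?_⟩
    rintro X _ ⟨x, hx, rfl⟩
    let t : A := (x : A ⧸ A₀).out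
    have htT : t ∈ T := ⟨_, rfl⟩
    have hb : x - t ∈ A₀ := by
      rw [sub_eq_neg_add, ← QuotientAddGroup.eq]
      exact Quotient.out_eq _
    obtain ⟨m, hm⟩ := AddSubgroup.mem_zmultiples_iff.1 <|
      h (AddSubgroup.zmultiples (x - t)) (by simpa using hb)
        ⟨_, AddSubgroup.mem_zmultiples _, rfl⟩
    have hφx : φ x = m • x + (φ t - m • t) := by
      rw [map_sub, smul_sub] at hm
      rw [← sub_eq_zero] at hm ⊢
      rw [← neg_eq_zero, ← hm]
      abel
    change φ x ∈ _
    rw [hφx]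
    exact AddSubgroup.add_mem_sup (X.zsmul_mem hx m) <| AddSubgroup.sub_mem _
      (AddSubgroup.subset_closure (.inr ⟨t, htT, rfl⟩))
      (AddSubgroup.zsmul_mem _ (AddSubgroup.subset_closure (.inl htT)) m)
  · rintro ⟨A₁, hfin, h⟩
    have hA₁ : A₁ ≤ A₁.comap φ := AddSubgroup.map_le_iff_le_comap.1 (by simpa using h A₁)
    let Φ := QuotientAddGroup.map A₁ A₁ φ hA₁
    have hΦ (x : A ⧸ A₁) : ∃ k : ℤ, Φ x = k • x := by
      obtain ⟨x, rfl⟩ := QuotientAddGroup.mk_surjective x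
      obtain ⟨_, hy, a, ha, hya⟩ := AddSubgroup.mem_sup.1 <|
        h (AddSubgroup.zmultiples x) ⟨x, AddSubgroup.mem_zmultiples x, rfl⟩
      obtain ⟨k, rfl⟩ := AddSubgroup.mem_zmultiples_iff.1 hy
      refine ⟨k, ?_⟩
      rw [QuotientAddGroup.map_mk, ← QuotientAddGroup.mk_zsmul]
      rw [eq_comm, QuotientAddGroup.eq]
      change k • x + a = φ x at hya
      rw [← hya]
      simpa using ha
    have htorq : IsAddTorsion (A ⧸ A₁) :=
      IsAddTorsion.of_surjective (QuotientAddGroup.mk'_surjective A₁) htor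
    classical
    obtain ⟨A₀, hindex, h₀⟩ := exists_finite_index_of_forall_finset φ A₁ hfin fun S => by
      obtain ⟨m, hm⟩ := exists_zsmul_eq_on_finset htorq Φ hΦ (S.image (QuotientAddGroup.mk' A₁))
      refine ⟨m, fun x hx => ?_⟩
      have := hm _ (Finset.mem_image_of_mem _ hx)
      rw [← QuotientAddGroup.eq_zero_iff, QuotientAddGroup.mk_sub, sub_eq_zero]
      exact this
    refine ⟨A₀, hindex, ?_⟩
    rintro X hX _ ⟨x, hx, rfl⟩
    obtain ⟨k, hk⟩ := h₀ x (hX hx)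
    rw [hk]
    exact X.zsmul_mem hx k
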